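/- arXiv:1503.04710 — 2 statements merged into one kernel-verified Lean document; each statement's English description precedes it below -/
import Mathlib

section
/- Let λ0 ≥ λ1 ≥ ... ≥ λM ≥ 0 > λ_{M+1} ≥ ... ≥ λn be real numbers. Suppose there exists a partition Λ1 ∪ Λ2 ∪ ... ∪ ΛS of the multiset {λ_{M+1}, λ_{M+2}, ..., λn} such that |Λj| is odd for each j = 1, 2, ..., min{M, S}, and, setting Tk = Σ_{λ ∈ Λk} λ, one has T_S ≥ T_{S−1} ≥ ... ≥ T_1 and, with K = { i ∈ {1,2,...,min{M,S}} : λi + Ti < 0 }: (1) λ0 + Σ_{i ∈ K, i < k} (λi + Ti) + Tk ≥ 0 for all k ∈ K, and (2) λ0 + Σ_{i ∈ K} (λi + Ti) + Σ_{j=M+1}^{S} Tj ≥ 0 (the last sum being empty when S ≤ M). Then there exists an (n+1)×(n+1) nonnegative bisymmetric real matrix whose eigenvalues (with multiplicity) are λ0, λ1, ..., λn. -/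
open Matrix Polynomial BigOperators

/-- The `n × n` reverse identity (exchange) matrix `J`, with entry `1` in
positions `(i, j)` with `i + j = n - 1` (0-based) and `0` elsewhere. -/
def revId (n : ℕ) : Matrix (Fin n) (Fin n) ℝ :=
  Matrix.of fun i j => if (i : ℕ) + (j : ℕ) + 1 = n then 1 else 0

/-- A square real matrix `Q` is bisymmetric if `Qᵀ = Q` and `JQJ = Q`. -/
def IsBisymm {n : ℕ} (Q : Matrix (Fin n) (Fin n) ℝ) : Prop :=
  Qᵀ = Q ∧ revId n * Q * revId n = Q

/-- Entrywise nonnegative matrix. -/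
def MatNonneg {n : ℕ} (Q : Matrix (Fin n) (Fin n) ℝ) : Prop :=
  ∀ i j, 0 ≤ Q i j

/-- Entrywise positive matrix. -/
def MatPos {n : ℕ} (Q : Matrix (Fin n) (Fin n) ℝ) : Prop :=
  ∀ i j, 0 < Q i j

/-- `lam 0, …, lam (n-1)` are the eigenvalues of `Q` with multiplicity, i.e. the
characteristic polynomial of `Q` is `∏ i (X - lam i)`. -/
def HasEigs {n : ℕ} (Q : Matrix (Fin n) (Fin n) ℝ) (lam : Fin n → ℝ) : Prop :=
  Q.charpoly = ∏ i, (X - Polynomial.C (lam i))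

/-- The multiset `μ` is the multiset of eigenvalues (with multiplicity) of `Q`. -/
def HasEigsM {n : ℕ} (Q : Matrix (Fin n) (Fin n) ℝ) (μ : Multiset ℝ) : Prop :=
  Q.charpoly = (μ.map fun a => X - Polynomial.C a).prod

/-- `r` is the Perron root of `Q`: it is a (real) eigenvalue of `Q` which equals the
spectral radius of `Q`, i.e. every complex eigenvalue of `Q` has modulus at most `r`. -/
def IsPerronRoot {n : ℕ} (Q : Matrix (Fin n) (Fin n) ℝ) (r : ℝ) : Prop :=
  r ∈ spectrum ℝ Q ∧ ∀ μ ∈ spectrum ℂ (Q.map fun a => (a : ℂ)), ‖μ‖ ≤ r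

lemma det_block_glue {ι κ : Type} [Fintype ι] [DecidableEq ι] [Fintype κ] [DecidableEq κ]
    (A : Matrix ι ι ℝ) (B : Matrix κ κ ℝ) (u : ι → ℝ) (v : κ → ℝ) (α β ρ x : ℝ)
    (hA : A *ᵥ u = α • u) (hB : B *ᵥ v = β • v) (hu : u ⬝ᵥ u = 1) (hv : v ⬝ᵥ v = 1)
    (hxa : x - α ≠ 0) (hxb : x - β ≠ 0) :
    (scalar (ι ⊕ κ) x - fromBlocks A (ρ • vecMulVec u v) (ρ • vecMulVec v u) B).det
      = (scalar ι x - A).det * (scalar κ x - B).det * (1 - ρ ^ 2 / ((x - α) * (x - β))) := by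
  have hfac : scalar (ι ⊕ κ) x - fromBlocks A (ρ • vecMulVec u v) (ρ • vecMulVec v u) B
      = fromBlocks (scalar ι x - A) 0 0 (scalar κ x - B) *
        fromBlocks 1 ((-(ρ / (x - α))) • vecMulVec u v) ((-(ρ / (x - β))) • vecMulVec v u) 1 := by
    rw [fromBlocks_multiply]
    have h1 : scalar (ι ⊕ κ) x = fromBlocks (scalar ι x) 0 0 (scalar κ x) := by
      ext i j
      rcases i with i | i <;> rcases j with j | j <;> simp [diagonal_apply]
    have hAu : (scalar ι x - A) *ᵥ u = (x - α) • u := by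
      rw [sub_mulVec, hA, sub_smul]; congr 1; ext i; simp [mulVec_diagonal]
    have hBv : (scalar κ x - B) *ᵥ v = (x - β) • v := by
      rw [sub_mulVec, hB, sub_smul]; congr 1; ext i; simp [mulVec_diagonal]
    rw [h1, sub_eq_add_neg, fromBlocks_neg, fromBlocks_add]
    simp only [← sub_eq_add_neg]
    congr 1
    · simp
    · rw [Matrix.mul_smul, mul_vecMulVec, hAu, smul_vecMulVec, smul_smul]
      rw [neg_mul, div_mul_cancel₀ _ hxa]; simp
    · rw [Matrix.zero_mul, add_comm] 
      rw [Matrix.mul_smul, mul_vecMulVec, hBv, smul_vecMulVec, smul_smul]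
      rw [neg_mul, div_mul_cancel₀ _ hxb]; simp 
    · simp
  rw [hfac, det_mul, det_fromBlocks_zero₂₁, det_fromBlocks_one₁₁]
  congr 1
  rw [Matrix.smul_mul, Matrix.mul_smul, vecMulVec_mul_vecMulVec, hu, one_smul, smul_smul,
    ← smul_vecMulVec, sub_eq_add_neg, ← neg_vecMulVec, vecMulVec_eq Unit,
    det_one_add_replicateCol_mul_replicateRow]
  simp [hv]
  field_simp
  ring

/-- Realizability by a symmetric nonnegative matrix commuting with an involution having `f`
fixed points, with an invariant nonnegative unit eigenvector for `μ`. -/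
def Rz (μ : ℝ) (L : Multiset ℝ) (f : ℕ) : Prop :=
  ∃ (ι : Type) (_ : Fintype ι) (_ : DecidableEq ι) (A : Matrix ι ι ℝ) (σ : ι → ι) (u : ι → ℝ),
    (∀ i, σ (σ i) = i) ∧ (∑ i, if σ i = i then 1 else 0) = f ∧ (∀ i j, 0 ≤ A i j) ∧
    (∀ i j, A j i = A i j) ∧ (∀ i j, A (σ i) (σ j) = A i j) ∧ (∀ i, 0 ≤ u i) ∧
    (∀ i, u (σ i) = u i) ∧ u ⬝ᵥ u = 1 ∧ A *ᵥ u = μ • u ∧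
    A.charpoly = ((μ ::ₘ L).map fun a => X - Polynomial.C a).prod

lemma Rz.congr {μ μ' : ℝ} {L L' : Multiset ℝ} {f f' : ℕ} (h : Rz μ L f) (h1 : μ = μ')
    (h2 : L = L') (h3 : f = f') : Rz μ' L' f' := by
  subst h1 h2 h3; exact h

lemma Rz.one {μ : ℝ} (h : 0 ≤ μ) : Rz μ 0 1 := by
  refine ⟨Unit, inferInstance, inferInstance, fun _ _ => μ, id, fun _ => 1, ?_, ?_, ?_, ?_, ?_, ?_, ?_, ?_, ?_, ?_⟩
  · simp
  · simp
  · simp [h]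
  · simp
  · simp
  · simp
  · simp
  · simp [dotProduct]
  · ext i; simp [mulVec, dotProduct]
  · simp [charpoly, charmatrix]
    rfl

lemma Rz.two {μ a : ℝ} (h : a ≤ μ) (h' : -a ≤ μ) : Rz μ {a} 0 := by
  refine ⟨Fin 2, inferInstance, inferInstance,
    !![(μ + a) / 2, (μ - a) / 2; (μ - a) / 2, (μ + a) / 2], ![1, 0],
    fun _ => √(1 / 2), ?_, ?_, ?_, ?_, ?_, ?_, ?_, ?_, ?_, ?_⟩
  · simp
  · simp 
  · intro i j; fin_cases i <;> fin_cases j <;> simp <;> linarith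
  · intro i j; fin_cases i <;> fin_cases j <;> simp
  · intro i j; fin_cases i <;> fin_cases j <;> simp
  · intro i; positivity
  · simp
  · have := Real.mul_self_sqrt (show (0 : ℝ) ≤ 1 / 2 by norm_num)
    simp only [dotProduct, Fin.sum_univ_two, this]; norm_num
  · ext i; fin_cases i <;> simp [mulVec, dotProduct, Fin.sum_univ_two] <;> ring
  · rw [charpoly_fin_two]
    simp only [trace_fin_two_of, det_fin_two_of, Multiset.map_cons, Multiset.map_singleton,
      Multiset.prod_cons, Multiset.prod_singleton]
    have e1 : (μ + a) / 2 + (μ + a) / 2 = μ + a := by ring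
    have e2 : (μ + a) / 2 * ((μ + a) / 2) - (μ - a) / 2 * ((μ - a) / 2) = μ * a := by ring
    rw [e1, e2]
    simp only [map_add, map_mul]
    ring

lemma Rz.glue {α β γ : ℝ} {L L' : Multiset ℝ} {f f' : ℕ} (hA : Rz α L f) (hB : Rz β L' f')
    (h1 : α ≤ γ) (h2 : β ≤ γ) : Rz γ ((α + β - γ) ::ₘ (L + L')) (f + f') := by
  obtain ⟨ι, _, _, A, σ, u, hσ, hf, hA0, hAs, hAσ, hu0, huσ, hu1, hAu, hAc⟩ := hA
  obtain ⟨κ, _, _, B, τ, v, hτ, hf', hB0, hBs, hBτ, hv0, hvτ, hv1, hBv, hBc⟩ := hB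
  obtain ⟨s, t, ρ, hs, ht, hρ, hst, e1, e2, hρ2⟩ : ∃ s t ρ : ℝ, 0 ≤ s ∧ 0 ≤ t ∧ 0 ≤ ρ ∧
      s ^ 2 + t ^ 2 = 1 ∧ α * s + ρ * t = γ * s ∧ ρ * s + β * t = γ * t ∧
      ρ ^ 2 = (γ - α) * (γ - β) := by
    by_cases hN : (γ - β) + (γ - α) = 0
    · refine ⟨1, 0, 0, by simp, by simp, by simp, by simp, ?_, by simp, ?_⟩
      · linarith
      · have : γ - α = 0 := by linarith
        rw [this]; ring
    · have hNp : 0 < (γ - β) + (γ - α) := lt_of_le_of_ne (by linarith) (Ne.symm hN)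
      have ha := Real.sq_sqrt (show 0 ≤ γ - α by linarith)
      have hb := Real.sq_sqrt (show 0 ≤ γ - β by linarith)
      have hn := Real.sq_sqrt hNp.le
      have hnp := Real.sqrt_pos.2 hNp
      set p := √(γ - α)
      set q := √(γ - β)
      set N := √((γ - β) + (γ - α))
      refine ⟨q / N, p / N, p * q, by positivity, by positivity, by positivity, ?_, ?_, ?_, ?_⟩
      · rw [div_pow, div_pow, hn, ha, hb]; field_simp
      · field_simp
        rw [ha]; ring
      · field_simp
        rw [hb]; ring
      · rw [mul_pow, ha, hb]
  refine ⟨ι ⊕ κ, inferInstance, inferInstance,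
    fromBlocks A (ρ • vecMulVec u v) (ρ • vecMulVec v u) B, Sum.map σ τ,
    Sum.elim (s • u) (t • v), ?_, ?_, ?_, ?_, ?_, ?_, ?_, ?_, ?_, ?_⟩
  · rintro (i | i) <;> simp [hσ, hτ]
  · rw [Fintype.sum_sum_type, ← hf, ← hf']; simp
  · rintro (i | i) (j | j) <;> simp [hA0, hB0, vecMulVec_apply]
    · exact mul_nonneg hρ (mul_nonneg (hu0 _) (hv0 _))
    · exact mul_nonneg hρ (mul_nonneg (hv0 _) (hu0 _))
  · rintro (i | i) (j | j) <;> simp [vecMulVec_apply, mul_comm]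
    · exact hAs i j
    · exact hBs i j
  · rintro (i | i) (j | j) <;> simp [hAσ, hBτ, vecMulVec_apply, huσ, hvτ]
  · rintro (i | i) <;> simp
    · exact mul_nonneg hs (hu0 _)
    · exact mul_nonneg ht (hv0 _)
  · rintro (i | i) <;> simp [huσ, hvτ]
  · simp only [sumElim_dotProduct_sumElim, smul_dotProduct, dotProduct_smul, hu1, hv1]
    simp; linarith
  · rw [fromBlocks_mulVec]
    ext (i | i)
    · have := congrFun hAu i
      simp [mulVec_smul, hAu, smul_mulVec, vecMulVec_mulVec, hv1] 
      linear_combination u i * e1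
    · simp [mulVec_smul, hBv, smul_mulVec, vecMulVec_mulVec, hu1] 
      linear_combination v i * e2
  · have key : (fromBlocks A (ρ • vecMulVec u v) (ρ • vecMulVec v u) B).charpoly
        * ((X - Polynomial.C α) * (X - Polynomial.C β))
        = A.charpoly * B.charpoly *
          ((X - Polynomial.C γ) * (X - Polynomial.C (α + β - γ))) := by
      apply Polynomial.eq_of_infinite_eval_eq
      refine (Set.Finite.infinite_compl (Set.toFinite ({α, β} : Set ℝ))).mono ?_
      intro x hx
      simp only [Set.mem_compl_iff, Set.mem_insert_iff, Set.mem_singleton_iff, not_or] at hx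
      have hxa := sub_ne_zero.2 hx.1
      have hxb := sub_ne_zero.2 hx.2
      simp only [Set.mem_ofPred_eq, eval_mul, eval_sub, eval_X, eval_C, eval_charpoly]
      rw [det_block_glue A B u v α β ρ x hAu hBv hu1 hv1 hxa hxb, hρ2]
      field_simp
      ring
    rw [hAc, hBc] at key
    have hne : (X - Polynomial.C α) * (X - Polynomial.C β) ≠ 0 :=
      mul_ne_zero (X_sub_C_ne_zero _) (X_sub_C_ne_zero _)
    apply mul_right_cancel₀ hne
    rw [key]
    simp only [Multiset.map_cons, Multiset.prod_cons, Multiset.map_add, Multiset.prod_add]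
    ring

lemma exists_cons_of_card {m : ℕ} {L : Multiset ℝ} (h : L.card = m + 1) :
    ∃ a L', L = a ::ₘ L' := by
  obtain ⟨a, ha⟩ := Multiset.card_pos_iff_exists_mem.1 (show 0 < L.card by omega)
  exact ⟨a, Multiset.exists_cons_of_mem ha⟩

lemma Rz.sul : ∀ (m : ℕ) (L : Multiset ℝ) (μ : ℝ), L.card = m → (∀ a ∈ L, a ≤ 0) →
    0 ≤ μ + L.sum → Rz μ L (if Even m then 1 else 0) := by
  intro m
  induction m using Nat.twoStepInduction with
  | zero =>
    intro L μ hL _ h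
    rw [Multiset.card_eq_zero] at hL
    subst hL
    simpa using Rz.one (by simpa using h)
  | one =>
    intro L μ hL h0 h
    obtain ⟨a, rfl⟩ := Multiset.card_eq_one.1 hL
    have := h0 a (by simp)
    simp at h
    simpa using Rz.two (μ := μ) (a := a) (by linarith) (by linarith)
  | more m ih _ =>
    intro L μ hL h0 h
    obtain ⟨a, L1, rfl⟩ := exists_cons_of_card (show L.card = (m + 1) + 1 from hL)
    obtain ⟨b, L2, rfl⟩ := exists_cons_of_card (show L1.card = m + 1 by simpa using hL)
    have ha := h0 a (by simp)
    have hb := h0 b (by simp)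
    have h0' : ∀ x ∈ L2, x ≤ 0 := fun x hx => h0 x (by simp [hx])
    have hs : L2.sum ≤ 0 := by
      have := Multiset.sum_le_card_nsmul L2 0 h0'
      simpa using this
    simp only [Multiset.sum_cons] at h
    have r1 := ih L2 (μ + a + b) (by simpa using hL) h0' (by linarith)
    have r2 := Rz.two (μ := -b) (a := b) (by linarith) (by linarith)
    refine (r1.glue r2 (γ := μ) (by linarith) (by linarith)).congr rfl ?_ ?_
    · rw [show μ + a + b + -b - μ = a by ring, ← Multiset.cons_zero, Multiset.add_cons, add_zero]
    · simp [Nat.even_add]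

lemma cycleType_invol {N : ℕ} (σ : Equiv.Perm (Fin N)) (h : ∀ i, σ (σ i) = i)
    (f : ℕ) (hf : (∑ i, if σ i = i then 1 else 0) = f) (hf1 : f ≤ 1) :
    σ.cycleType = Multiset.replicate (N / 2) 2 := by
  have h2 : ∀ b ∈ σ.cycleType, b = 2 := by
    intro b hb
    have h1 := Equiv.Perm.two_le_of_mem_cycleType hb
    have h3 := (Equiv.Perm.dvd_of_mem_cycleType hb).trans
      (orderOf_dvd_of_pow_eq_one (n := 2) (by ext i; simp [pow_two, h]))
    exact le_antisymm (Nat.le_of_dvd (by norm_num) h3) h1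
  have h3 := Equiv.Perm.sum_cycleType σ
  have h4 : σ.cycleType = Multiset.replicate σ.cycleType.card 2 :=
    Multiset.eq_replicate.2 ⟨rfl, h2⟩
  have h5 : σ.support.card + f = N := by
    rw [← hf, ← Finset.card_filter]
    have := Finset.card_filter_add_card_filter_not (s := (Finset.univ : Finset (Fin N)))
      (fun i => σ i = i)
    simp only [Finset.card_univ, Fintype.card_fin] at this
    have e : σ.support = Finset.univ.filter (fun i => ¬ σ i = i) := by
      ext i; simp
    rw [e]; omega
  rw [h4, Multiset.sum_replicate] at h3
  rw [h4]
  congr 1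
  simp at h3
  omega

lemma Rz.final {n : ℕ} {μ : ℝ} {L : Multiset ℝ} {f : ℕ} (h : Rz μ L f) (hf1 : f ≤ 1)
    (lam : ℕ → ℝ) (hL : μ ::ₘ L = (Multiset.range (n + 1)).map lam) :
    ∃ Q : Matrix (Fin (n + 1)) (Fin (n + 1)) ℝ,
      MatNonneg Q ∧ IsBisymm Q ∧ HasEigs Q fun i => lam (i : ℕ) := by
  obtain ⟨ι, _, _, A, σ, u, hσ, hf, hA0, hAs, hAσ, hu0, huσ, hu1, hAu, hAc⟩ := h
  have hcard : Fintype.card ι = n + 1 := by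
    have h1 := A.charpoly_natDegree_eq_dim
    rw [hAc, hL] at h1
    rw [← h1]
    rw [Polynomial.natDegree_multiset_prod_X_sub_C_eq_card]
    simp
  let e : ι ≃ Fin (n + 1) := Fintype.equivFinOfCardEq hcard
  let σp : Equiv.Perm ι := ⟨σ, σ, hσ, hσ⟩
  let s : Equiv.Perm (Fin (n + 1)) := (e.symm.trans σp).trans e
  have hs : s.cycleType = Multiset.replicate ((n + 1) / 2) 2 := by
    refine cycleType_invol s ?_ f ?_ hf1
    · intro i; simp [s, σp, hσ]
    · rw [← hf]
      refine (Fintype.sum_equiv e _ _ ?_).symm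
      intro i
      simp [s, σp]
  have hr : (Fin.revPerm : Equiv.Perm (Fin (n + 1))).cycleType
      = Multiset.replicate ((n + 1) / 2) 2 := by
    refine cycleType_invol _ (by simp) _ rfl ?_
    rw [← Finset.card_filter, Finset.card_le_one]
    intro a ha b hb
    simp [Fin.ext_iff, Fin.val_rev] at ha hb
    ext; omega
  obtain ⟨c, hc⟩ := isConj_iff.1 (Equiv.Perm.isConj_iff_cycleType_eq.2 (hs.trans hr.symm))
  let g : ι ≃ Fin (n + 1) := e.trans c
  have hg : ∀ i, g.symm (Fin.rev i) = σ (g.symm i) := by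
    intro i
    have := congrArg (fun p => p i) hc
    simp [s, σp, Equiv.Perm.mul_apply] at this
    rw [← this]
    simp [g]
  have hJ : ∀ Q : Matrix (Fin (n + 1)) (Fin (n + 1)) ℝ, revId (n + 1) * Q * revId (n + 1)
      = fun i j => Q i.rev j.rev := by
    intro Q
    have e1 : ∀ i k : Fin (n + 1), revId (n + 1) i k = if k = i.rev then 1 else 0 := by
      intro i k
      simp only [revId, of_apply]
      congr 1
      simp [Fin.ext_iff, Fin.val_rev]; omega
    have e2 : ∀ i k : Fin (n + 1), revId (n + 1) i k = if i = k.rev then 1 else 0 := by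
      intro i k
      simp only [revId, of_apply]
      congr 1
      simp [Fin.ext_iff, Fin.val_rev]; omega
    ext i j
    rw [Matrix.mul_apply]
    simp_rw [e2 _ j, Matrix.mul_apply, e1 i]
    simp
  refine ⟨reindex g g A, ?_, ⟨?_, ?_⟩, ?_⟩
  · intro i j; simp [hA0]
  · ext i j; simp [hAs (g.symm i) (g.symm j)]
  · rw [hJ]; ext i j; simp [hg, hAσ]
  · rw [HasEigs, charpoly_reindex, hAc, hL, Multiset.map_map]
    rw [← Finset.prod_range (fun i => X - Polynomial.C (lam i))]
    rfl

lemma Rz.many {I : Type} [DecidableEq I] {γ : ℝ} {L : Multiset ℝ} {f : ℕ} (h : Rz γ L f)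
    (s : Finset I) (b : I → ℝ) (P : I → Multiset ℝ) (hP : ∀ i ∈ s, Rz (b i) (P i) 0)
    (hb : ∀ i ∈ s, b i ≤ γ) : Rz γ (L + ∑ i ∈ s, (b i ::ₘ P i)) f := by
  induction s using Finset.induction_on with
  | empty => simpa using h
  | insert a s ha ih =>
    have r := ih (fun i hi => hP i (by simp [hi])) (fun i hi => hb i (by simp [hi]))
    refine (r.glue (hP a (by simp)) le_rfl (hb a (by simp))).congr rfl ?_ (by simp)
    rw [Finset.sum_insert ha, add_sub_cancel_left]
    simp only [← Multiset.singleton_add]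
    abel

lemma Rz.kellogg {I : Type} [LinearOrder I] {L : Multiset ℝ} {f : ℕ} (K : Finset I)
    (l T : I → ℝ) (P : I → Multiset ℝ) (hP : ∀ i ∈ K, Rz (-T i) (P i) 0)
    (hneg : ∀ i ∈ K, l i + T i < 0) : ∀ c : ℝ,
    (∀ k ∈ K, 0 ≤ c + (∑ i ∈ K.filter fun i => i < k, (l i + T i)) + T k) →
    Rz (c + ∑ i ∈ K, (l i + T i)) L f → Rz c (L + ∑ i ∈ K, (l i ::ₘ P i)) f := by
  induction K using Finset.induction_on_min with
  | empty => intro c _ h; simpa using h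
  | insert a s ha ih =>
    intro c hc h
    have has : a ∉ s := fun h => lt_irrefl _ (ha a h)
    have r := ih (fun i hi => hP i (by simp [hi])) (fun i hi => hneg i (by simp [hi]))
      (c + (l a + T a)) (by
        intro k hk
        have := hc k (by simp [hk])
        rw [Finset.filter_insert, if_pos (ha k hk), Finset.sum_insert (by simp [has])] at this
        linarith) (h.congr (by rw [Finset.sum_insert has]; ring) rfl rfl)
    have hca := hc a (by simp)
    have he : (insert a s).filter (fun i => i < a) = ∅ := by
      ext x
      simp only [Finset.mem_filter, Finset.mem_insert, Finset.notMem_empty, iff_false, not_and]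
      rintro (rfl | hx)
      · exact lt_irrefl _
      · exact (ha x hx).not_gt
    rw [he, Finset.sum_empty] at hca
    have hna := hneg a (by simp)
    refine (r.glue (hP a (by simp)) (γ := c) (by linarith) (by linarith)).congr rfl ?_ (by simp)
    rw [Finset.sum_insert has, show c + (l a + T a) + -T a - c = l a by ring]
    simp only [← Multiset.singleton_add]
    abel

lemma sum_pairs (lam : ℕ → ℝ) (S m : ℕ) :
    ∑ t ∈ Finset.range m, (lam (S + 2 * t + 1) ::ₘ ({lam (S + 2 * t + 2)} : Multiset ℝ))
      = ∑ i ∈ Finset.range (2 * m), ({lam (S + i + 1)} : Multiset ℝ) := by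
  induction m with
  | zero => simp
  | succ m ih =>
    rw [Finset.sum_range_succ, ih, show 2 * (m + 1) = 2 * m + 1 + 1 by ring,
      Finset.sum_range_succ, Finset.sum_range_succ, ← Multiset.singleton_add, ← add_assoc]
    rfl

lemma sum_singletons (lam : ℕ → ℝ) (s : Finset ℕ) :
    ∑ i ∈ s, ({lam i} : Multiset ℝ) = s.val.map lam := by
  have := Multiset.sum_map_singleton (s.val.map lam)
  rw [Multiset.map_map] at this
  exact this

lemma sum_fin_filter (g : ℕ → Multiset ℝ) (M S : ℕ) :
    ∑ j ∈ Finset.univ.filter (fun j : Fin S => (j : ℕ) < M), g j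
      = ∑ i ∈ Finset.range (min S M), g i := by
  rw [Finset.sum_filter, Fin.sum_univ_eq_sum_range (fun i => if i < M then g i else 0) S,
    ← Finset.sum_filter]
  congr 1
  ext i; simp

/-- Borobia-type condition for the BNIEP, general case (Theorem 3.6): with a partition
`Λ₁ ∪ … ∪ Λ_S` of the negative part into parts of odd size for `j = 1, …, min{M,S}`,
part sums `T_S ≥ … ≥ T₁`, and Kellogg-type inequalities, the list `λ₀, …, λₙ` is
realizable by a nonnegative bisymmetric matrix. (Here `Λ j`, `T j`, `j : Fin S`,
represent `Λ_{j+1}`, `T_{j+1}`.) -/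
theorem bniep_borobia (n M S : ℕ) (hMn : M ≤ n)
    (lam : ℕ → ℝ)
    (hanti : ∀ i j, i ≤ j → j ≤ n → lam j ≤ lam i)
    (hM0 : 0 ≤ lam M)
    (hneg : ∀ i, M < i → i ≤ n → lam i < 0)
    (Λ : Fin S → Multiset ℝ)
    (hpart : (∑ j, Λ j) = (Finset.Icc (M + 1) n).val.map lam)
    (hodd : ∀ j : Fin S, (j : ℕ) < min M S → Odd (Multiset.card (Λ j)))
    (T : Fin S → ℝ) (hT : ∀ j, T j = (Λ j).sum)
    (hTmono : Monotone T)
    (K : Finset (Fin S))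
    (hK : K = Finset.univ.filter fun i : Fin S =>
      (i : ℕ) < min M S ∧ lam ((i : ℕ) + 1) + T i < 0)
    (h1 : ∀ k ∈ K,
      0 ≤ lam 0 + (∑ i ∈ K.filter fun i => i < k, (lam ((i : ℕ) + 1) + T i)) + T k)
    (h2 : 0 ≤ lam 0 + (∑ i ∈ K, (lam ((i : ℕ) + 1) + T i))
        + ∑ j ∈ Finset.univ.filter fun j : Fin S => M ≤ (j : ℕ), T j) :
    ∃ Q : Matrix (Fin (n + 1)) (Fin (n + 1)) ℝ,
      MatNonneg Q ∧ IsBisymm Q ∧ HasEigs Q fun i => lam (i : ℕ) := by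
  classical
  have hΛneg : ∀ j, ∀ a ∈ Λ j, a ≤ 0 := by
    intro j a ha
    have : a ∈ ∑ j, Λ j := by
      rw [Multiset.mem_sum]; exact ⟨j, Finset.mem_univ _, ha⟩
    rw [hpart, Multiset.mem_map] at this
    obtain ⟨i, hi, rfl⟩ := this
    rw [Finset.mem_val, Finset.mem_Icc] at hi
    exact (hneg i (by omega) hi.2).le
  have hblock : ∀ (j : Fin S) (μ : ℝ), (j : ℕ) < M → 0 ≤ μ + T j → Rz μ (Λ j) 0 := by
    intro j μ hj h
    rw [hT] at h
    have ho := hodd j (by have := j.2; omega)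
    refine (Rz.sul _ (Λ j) μ rfl (hΛneg j) h).congr rfl rfl ?_
    rw [if_neg (Nat.not_even_iff_odd.2 ho)]
  have hKm : ∀ i : Fin S, i ∈ K ↔ (i : ℕ) < M ∧ lam ((i : ℕ) + 1) + T i < 0 := by
    intro i; rw [hK]; have := i.2; simp
  -- the base block
  set B := ∑ j ∈ Finset.univ.filter (fun j : Fin S => ¬ (j : ℕ) < M), Λ j with hB
  set c := lam 0 + ∑ i ∈ K, (lam ((i : ℕ) + 1) + T i) with hc
  have hBsum : B.sum = ∑ j ∈ Finset.univ.filter fun j : Fin S => M ≤ (j : ℕ), T j := by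
    rw [hB, Multiset.sum_sum]
    simp only [not_lt, hT]
  have hB0 : ∀ a ∈ B, a ≤ 0 := by
    intro a ha
    rw [hB, Multiset.mem_sum] at ha
    obtain ⟨j, _, hj⟩ := ha
    exact hΛneg j a hj
  have hcM : S < M → lam M ≤ c := by
    intro hSM
    rcases K.eq_empty_or_nonempty with h0 | h0
    · rw [hc, h0]; simpa using hanti 0 M (by omega) hMn
    · have hk := K.max'_mem h0
      set k := K.max' h0
      have h := h1 k hk
      have he : K.filter (fun i => i < k) = K.erase k := by
        ext x
        simp only [Finset.mem_filter, Finset.mem_erase]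
        constructor
        · rintro ⟨hx, hlt⟩; exact ⟨hlt.ne, hx⟩
        · rintro ⟨hne, hx⟩; exact ⟨hx, lt_of_le_of_ne (K.le_max' x hx) hne⟩
      rw [he] at h
      have h3 := Finset.add_sum_erase K (fun i : Fin S => lam ((i : ℕ) + 1) + T i) hk
      have h4 := hanti ((k : ℕ) + 1) M (by have := k.2; omega) hMn
      linarith
  obtain ⟨f, hf1, hbase⟩ : ∃ f, f ≤ 1 ∧
      Rz c (B + if Odd (M - S) then {lam M} else 0) f := by
    by_cases ho : Odd (M - S)
    · have hSM : S < M := by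
        by_contra h
        rw [Nat.sub_eq_zero_of_le (by omega)] at ho
        simp at ho
      have hBz : B = 0 := by
        rw [hB]
        apply Finset.sum_eq_zero
        intro j hj
        have := j.2
        simp at hj
        omega
      refine ⟨0, by omega, ?_⟩
      rw [if_pos ho, hBz, zero_add]
      have := hcM hSM
      exact Rz.two this (by linarith)
    · refine ⟨_, ?_, (Rz.sul _ B c rfl hB0 (by rw [hBsum]; exact h2)).congr rfl
        (by rw [if_neg ho, add_zero]) rfl⟩
      split_ifs <;> simp
  have r1 := Rz.kellogg K (fun i : Fin S => lam ((i : ℕ) + 1)) T Λ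
    (fun i hi => hblock i _ ((hKm i).1 hi).1 (by linarith)) (fun i hi => ((hKm i).1 hi).2)
    (lam 0) h1 hbase
  have r2 := r1.many ((Finset.univ.filter (fun j : Fin S => (j : ℕ) < M)) \ K)
    (fun i : Fin S => lam ((i : ℕ) + 1)) Λ (by
      intro i hi
      simp only [Finset.mem_sdiff, Finset.mem_filter, Finset.mem_univ, true_and, hKm, not_and,
        not_lt] at hi
      exact hblock i _ hi.1 (hi.2 hi.1)) (by
      intro i hi
      simp only [Finset.mem_sdiff, Finset.mem_filter, Finset.mem_univ, true_and] at hi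
      exact hanti _ _ (by omega) (by omega))
  have r3 := r2.many (Finset.range ((M - S) / 2)) (fun t => lam (S + 2 * t + 1))
    (fun t => {lam (S + 2 * t + 2)}) (by
      intro t ht
      rw [Finset.mem_range] at ht
      have a1 := hanti (S + 2 * t + 1) (S + 2 * t + 2) (by omega) (by omega)
      have a2 := hanti (S + 2 * t + 2) M (by omega) (by omega)
      exact Rz.two a1 (by linarith)) (by
      intro t ht
      rw [Finset.mem_range] at ht
      exact hanti _ _ (by omega) (by omega))
  refine r3.final hf1 lam ?_
  have hKsub : K ⊆ Finset.univ.filter (fun j : Fin S => (j : ℕ) < M) := by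
    intro i hi; simpa using ((hKm i).1 hi).1
  have e1 : ∑ i ∈ Finset.univ.filter (fun j : Fin S => (j : ℕ) < M) \ K,
      (lam ((i : ℕ) + 1) ::ₘ Λ i) + ∑ i ∈ K, (lam ((i : ℕ) + 1) ::ₘ Λ i)
      = ∑ i ∈ Finset.range (min S M), {lam (i + 1)}
        + ∑ i ∈ Finset.univ.filter (fun j : Fin S => (j : ℕ) < M), Λ i := by
    rw [Finset.sum_sdiff hKsub, ← sum_fin_filter (fun i => {lam (i + 1)}), ← Finset.sum_add_distrib]
    simp only [Multiset.singleton_add]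
  have e2 : ∑ i ∈ Finset.univ.filter (fun j : Fin S => (j : ℕ) < M), Λ i + B
      = (Finset.Icc (M + 1) n).val.map lam := by
    rw [← hpart, hB, Finset.sum_filter_add_sum_filter_not]
  have e3 : ∑ i ∈ Finset.range (min S M), ({lam (i + 1)} : Multiset ℝ) +
      (∑ t ∈ Finset.range ((M - S) / 2),
        (lam (S + 2 * t + 1) ::ₘ ({lam (S + 2 * t + 2)} : Multiset ℝ))
      + if Odd (M - S) then {lam M} else 0) = ∑ i ∈ Finset.range M, {lam (i + 1)} := by
    have e4 : (∑ t ∈ Finset.range ((M - S) / 2),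
        (lam (S + 2 * t + 1) ::ₘ ({lam (S + 2 * t + 2)} : Multiset ℝ))
      + if Odd (M - S) then {lam M} else 0) = ∑ i ∈ Finset.range (M - S), {lam (S + i + 1)} := by
      rw [sum_pairs]
      split_ifs with ho
      · obtain ⟨q, hq⟩ := ho
        rw [show (M - S) / 2 = q by omega, hq, Finset.sum_range_succ,
          show S + 2 * q + 1 = M by omega]
      · rw [Nat.not_odd_iff_even, Nat.even_iff] at ho
        rw [add_zero, show 2 * ((M - S) / 2) = M - S by omega]
    rw [e4]
    by_cases h : S ≤ M
    · obtain ⟨q, rfl⟩ := Nat.exists_eq_add_of_le h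
      rw [min_eq_left h, Nat.add_sub_cancel_left, Finset.sum_range_add]
    · rw [min_eq_right (by omega), Nat.sub_eq_zero_of_le (by omega)]
      simp
  have e5 : (Multiset.range (n + 1)).map lam = lam 0 ::ₘ (∑ i ∈ Finset.range M, {lam (i + 1)}
      + (Finset.Icc (M + 1) n).val.map lam) := by
    rw [← sum_singletons, show Multiset.range (n + 1) = (Finset.range (n + 1)).val from rfl,
      ← sum_singletons, Finset.sum_range_succ', add_comm, Multiset.singleton_add]
    congr 1
    obtain ⟨q, rfl⟩ := Nat.exists_eq_add_of_le hMn
    rw [Finset.sum_range_add]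
    congr 1
    rw [← Finset.Ico_succ_right_eq_Icc, Finset.sum_Ico_eq_sum_range]
    simp only [Order.succ_eq_add_one]
    rw [show M + q + 1 - (M + 1) = q by omega]
    exact Finset.sum_congr rfl fun i _ => by rw [show M + i + 1 = M + 1 + i by omega]
  rw [e5, ← e2, ← e3]
  congr 1
  set D : Multiset ℝ := if Odd (M - S) then {lam M} else 0
  calc _ = B + D + (∑ i ∈ Finset.univ.filter (fun j : Fin S => (j : ℕ) < M) \ K,
      (lam ((i : ℕ) + 1) ::ₘ Λ i) + ∑ i ∈ K, (lam ((i : ℕ) + 1) ::ₘ Λ i))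
      + ∑ t ∈ Finset.range ((M - S) / 2),
        (lam (S + 2 * t + 1) ::ₘ ({lam (S + 2 * t + 2)} : Multiset ℝ)) := by abel
    _ = _ := by rw [e1]; abel
end

section
/- Let Q be an (n+1)×(n+1) nonnegative bisymmetric real matrix whose eigenvalues (with multiplicity) are λ0, λ1 ≥ λ2 ≥ ... ≥ λn, where λ0 is the Perron root of Q. Then for every ε > 0 there exists an (n+1)×(n+1) positive bisymmetric real matrix whose eigenvalues (with multiplicity) are λ0 + ε, λ1, ..., λn. -/
open Matrix Polynomial BigOperators

lemma rank_one_charpoly {n : ℕ} (Q : Matrix (Fin (n+1)) (Fin (n+1)) ℝ) (v : Fin (n+1) → ℝ)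
    (r e : ℝ) (hQ : Q *ᵥ v = r • v) (hv : v ⬝ᵥ v = 1) :
    (X - C r) * (Q + e • vecMulVec v v).charpoly = (X - C (r + e)) * Q.charpoly := by
  have key : (X - C r) ^ n * ((X - C r) * (Q + e • vecMulVec v v).charpoly)
      = (X - C r) ^ n * ((X - C (r + e)) * Q.charpoly) := by
    apply Polynomial.funext
    intro t
    have h1 : (Matrix.scalar (Fin (n+1)) t - Q) *
        (Matrix.scalar (Fin (n+1)) (t - r) - e • vecMulVec v v)
        = (t - r) • (Matrix.scalar (Fin (n+1)) t - (Q + e • vecMulVec v v)) := by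
      have hs : ∀ a : ℝ, Matrix.scalar (Fin (n+1)) a = a • (1 : Matrix _ _ ℝ) := by
        intro a; ext i j; simp [Matrix.one_apply, Matrix.diagonal_apply]
      rw [hs, hs]
      simp only [sub_mul, mul_sub, smul_mul_assoc, mul_smul_comm, one_mul, mul_one,
        mul_vecMulVec, hQ]
      ext i j
      simp only [Matrix.sub_apply, Matrix.smul_apply, Matrix.add_apply, vecMulVec_apply,
        Pi.smul_apply, smul_eq_mul]
      ring
    have h2 := congrArg Matrix.det h1
    rw [Matrix.det_mul, Matrix.det_smul] at h2
    have h3 : (Matrix.scalar (Fin (n+1)) (t - r) - e • vecMulVec v v).det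
        = (t - r) ^ (n+1) - e * (t - r) ^ n := by
      rw [← Matrix.eval_charpoly, ← smul_vecMulVec, charpoly_vecMulVec]
      simp [hv]
    rw [h3, ← Matrix.eval_charpoly, ← Matrix.eval_charpoly] at h2
    simp only [Fintype.card_fin] at h2
    simp only [eval_mul, eval_pow, eval_sub, eval_X, eval_C]
    linear_combination -h2
  exact mul_left_cancel₀ (pow_ne_zero _ (X_sub_C_ne_zero r)) key

lemma revId_apply {n : ℕ} (i j : Fin n) : revId n i j = if j = i.rev then 1 else 0 := by
  simp only [revId, Matrix.of_apply]
  congr 1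
  simp only [Fin.ext_iff, Fin.val_rev, eq_iff_iff]
  omega

lemma isBisymm_iff {n : ℕ} (Q : Matrix (Fin n) (Fin n) ℝ) :
    IsBisymm Q ↔ (∀ i j, Q i j = Q j i) ∧ ∀ i j, Q i.rev j.rev = Q i j := by
  have h : ∀ i j, (revId n * Q * revId n) i j = Q i.rev j.rev := by
    intro i j
    have : ∀ k : Fin n, (j = k.rev) = (k = j.rev) := by
      intro k; apply propext; constructor <;> (rintro rfl; simp)
    simp [Matrix.mul_apply, revId_apply, this]
  constructor
  · rintro ⟨h1, h2⟩
    refine ⟨fun i j => ?_, fun i j => ?_⟩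
    · conv_rhs => rw [← h1]
      rfl
    · rw [← h, h2]
  · rintro ⟨h1, h2⟩
    refine ⟨?_, ?_⟩
    · ext i j; exact h1 j i
    · ext i j; rw [h, h2]

lemma rev_mulVec {n : ℕ} {Q : Matrix (Fin n) (Fin n) ℝ} (hQ : ∀ i j, Q i.rev j.rev = Q i j)
    (x : Fin n → ℝ) (i : Fin n) : (Q *ᵥ fun k => x k.rev) i = (Q *ᵥ x) i.rev := by
  simp only [Matrix.mulVec, dotProduct]
  rw [← Equiv.sum_comp Fin.revPerm]
  simp [← hQ i]

lemma psd_of_perron {n : ℕ} {Q : Matrix (Fin n) (Fin n) ℝ} {r : ℝ} (hs : ∀ i j, Q i j = Q j i)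
    (h : IsPerronRoot Q r) : (r • (1 : Matrix _ _ ℝ) - Q).PosSemidef := by
  rw [posSemidef_iff_isHermitian_and_spectrum_nonneg]
  refine ⟨?_, ?_⟩
  · ext i j
    simp [Matrix.one_apply, hs i j, eq_comm]
  · intro μ hμ
    rw [Matrix.mem_spectrum_iff_isRoot_charpoly, IsRoot, Matrix.eval_charpoly] at hμ
    have h1 : IsRoot Q.charpoly (r - μ) := by
      rw [IsRoot, Matrix.eval_charpoly]
      have : Matrix.scalar (Fin n) (r - μ) - Q
          = - (Matrix.scalar (Fin n) μ - (r • (1 : Matrix _ _ ℝ) - Q)) := by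
        ext i j
        by_cases hij : i = j
        · subst hij; simp; ring
        · simp [hij]
      rw [this, Matrix.det_neg, hμ, mul_zero]
    have h2 : IsRoot (Q.map fun a => (a : ℂ)).charpoly ((r - μ : ℝ) : ℂ) := by
      have := Matrix.charpoly_map Q Complex.ofRealHom
      have h3 : (Q.map fun a => (a : ℂ)).charpoly = Q.charpoly.map Complex.ofRealHom := this
      rw [h3]
      exact h1.map (f := Complex.ofRealHom)
    have h4 := h.2 _ (Matrix.mem_spectrum_iff_isRoot_charpoly.2 h2)
    rw [Complex.norm_real, Real.norm_eq_abs] at h4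
    have := le_abs_self (r - μ)
    simp only [Set.mem_ofPred_eq]
    linarith

/-- Rayleigh bound. -/
lemma rayleigh {n : ℕ} {Q : Matrix (Fin n) (Fin n) ℝ} {r : ℝ} (hs : ∀ i j, Q i j = Q j i)
    (h : IsPerronRoot Q r) (x : Fin n → ℝ) : x ⬝ᵥ (Q *ᵥ x) ≤ r * (x ⬝ᵥ x) := by
  have := (posSemidef_iff_dotProduct_mulVec.1 (psd_of_perron hs h)).2 x
  simp [sub_mulVec, smul_mulVec, dotProduct_sub] at this
  linarith

lemma dot_self_pos {n : ℕ} {x : Fin n → ℝ} (hx : x ≠ 0) : 0 < x ⬝ᵥ x := by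
  have h0 : 0 ≤ x ⬝ᵥ x := Finset.sum_nonneg fun i _ => mul_self_nonneg _
  exact lt_of_le_of_ne h0 fun h => hx (dotProduct_self_eq_zero.1 h.symm)

lemma mulVec_nonneg_aux {n : ℕ} {Q : Matrix (Fin n) (Fin n) ℝ} (hnn : MatNonneg Q)
    {x : Fin n → ℝ} (hx : ∀ i, 0 ≤ x i) (i : Fin n) : 0 ≤ (Q *ᵥ x) i := by
  simp only [mulVec, dotProduct]
  exact Finset.sum_nonneg fun j _ => mul_nonneg (hnn i j) (hx j)

lemma mulVec_mono_aux {n : ℕ} {Q : Matrix (Fin n) (Fin n) ℝ} (hnn : MatNonneg Q)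
    {x y : Fin n → ℝ} (hx : ∀ i, x i ≤ y i) (i : Fin n) : (Q *ᵥ x) i ≤ (Q *ᵥ y) i := by
  simp only [mulVec, dotProduct]
  exact Finset.sum_le_sum fun j _ => mul_le_mul_of_nonneg_left (hx j) (hnn i j)

lemma exists_perron_vec {n : ℕ} {Q : Matrix (Fin n) (Fin n) ℝ} {r : ℝ}
    (hnn : MatNonneg Q) (hs : ∀ i j, Q i j = Q j i) (hr : ∀ i j, Q i.rev j.rev = Q i j)
    (h : IsPerronRoot Q r) : ∃ v : Fin n → ℝ, (∀ i, 0 ≤ v i) ∧ (∀ i, v i.rev = v i) ∧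
      v ⬝ᵥ v = 1 ∧ Q *ᵥ v = r • v := by
  have h1 := Matrix.mem_spectrum_iff_isRoot_charpoly.1 h.1
  rw [IsRoot, Matrix.eval_charpoly, ← Matrix.exists_mulVec_eq_zero_iff] at h1
  obtain ⟨x, hx0, hx⟩ := h1
  have hx' : Q *ᵥ x = r • x := by
    rw [sub_mulVec, sub_eq_zero] at hx
    rw [← hx]
    ext i; simp [mulVec_diagonal]
  set y : Fin n → ℝ := fun i => |x i| with hy
  have hyy : y ⬝ᵥ y = x ⬝ᵥ x := by simp [hy, dotProduct]
  have hge : x ⬝ᵥ (Q *ᵥ x) ≤ y ⬝ᵥ (Q *ᵥ y) := by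
    simp only [dotProduct, mulVec, Finset.mul_sum]
    refine Finset.sum_le_sum fun i _ => Finset.sum_le_sum fun j _ => ?_
    refine (le_abs_self _).trans ?_
    rw [abs_mul, abs_mul, abs_of_nonneg (hnn i j)]
  have hyQ : Q *ᵥ y = r • y := by
    have h2 := rayleigh hs h y
    have h3 : y ⬝ᵥ (Q *ᵥ y) = r * (y ⬝ᵥ y) := by
      apply le_antisymm h2
      rw [hyy]
      refine le_trans (le_of_eq ?_) hge
      rw [hx', dotProduct_smul, smul_eq_mul]
    have h4 := ((psd_of_perron hs h).dotProduct_mulVec_zero_iff y).1 (by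
      simp [sub_mulVec, smul_mulVec, dotProduct_sub, h3])
    rw [sub_mulVec, smul_mulVec, one_mulVec, sub_eq_zero] at h4
    exact h4.symm
  set u : Fin n → ℝ := fun i => y i + y i.rev with hu
  have huQ : Q *ᵥ u = r • u := by
    have : u = y + fun i => y i.rev := rfl
    rw [this, mulVec_add, hyQ]
    ext i
    simp [rev_mulVec hr, hyQ, mul_add]
  have hu0 : u ≠ 0 := by
    obtain ⟨i, hi⟩ := Function.ne_iff.1 hx0
    refine Function.ne_iff.2 ⟨i, ?_⟩
    have : 0 < |x i| := abs_pos.2 hi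
    have : 0 ≤ |x i.rev| := abs_nonneg _
    simp only [hu, hy, Pi.zero_apply]
    positivity
  have hpos := dot_self_pos hu0
  refine ⟨(Real.sqrt (u ⬝ᵥ u))⁻¹ • u, ?_, ?_, ?_, ?_⟩
  · intro i
    simp only [hu, hy, Pi.smul_apply, smul_eq_mul]
    positivity
  · intro i
    simp [hu, add_comm]
  · rw [smul_dotProduct, dotProduct_smul, smul_eq_mul, smul_eq_mul, ← mul_assoc, ← mul_inv,
      Real.mul_self_sqrt hpos.le, inv_mul_cancel₀ hpos.ne']
  · rw [mulVec_smul, huQ, smul_comm]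

lemma exists_sub_vec {n : ℕ} {Q : Matrix (Fin n) (Fin n) ℝ} {r l : ℝ}
    (hnn : MatNonneg Q) (hs : ∀ i j, Q i j = Q j i) (hr : ∀ i j, Q i.rev j.rev = Q i j)
    (h : IsPerronRoot Q r) (hr0 : 0 ≤ r) (hl : r < l) :
    ∃ z : Fin n → ℝ, (∀ i, 0 < z i) ∧ (∀ i, z i.rev = z i) ∧ ∀ i, (Q *ᵥ z) i < l * z i := by
  have hdet : (l • (1 : Matrix _ _ ℝ) - Q).det ≠ 0 := by
    intro h0
    rw [← Matrix.exists_mulVec_eq_zero_iff] at h0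
    obtain ⟨x, hx0, hx⟩ := h0
    rw [sub_mulVec, smul_mulVec, one_mulVec, sub_eq_zero] at hx
    have h1 := rayleigh hs h x
    have h2 := dot_self_pos hx0
    rw [← hx, dotProduct_smul, smul_eq_mul] at h1
    nlinarith
  have hex : ∃ z, (l • (1 : Matrix _ _ ℝ) - Q) *ᵥ z = fun _ => 1 := by
    refine ⟨(l • (1 : Matrix _ _ ℝ) - Q)⁻¹ *ᵥ fun _ => 1, ?_⟩
    rw [mulVec_mulVec, Matrix.mul_nonsing_inv _ (isUnit_iff_ne_zero.2 hdet), one_mulVec]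
  obtain ⟨z, hz⟩ := hex
  have hz' : ∀ i, l * z i = 1 + (Q *ᵥ z) i := by
    intro i
    have := congrFun hz i
    simp [sub_mulVec, smul_mulVec] at this
    linarith
  -- negative part
  set m : Fin n → ℝ := fun i => max (- z i) 0 with hm
  have hm0 : ∀ i, 0 ≤ m i := fun i => le_max_right _ _
  have hzm : ∀ i, m i * z i = - (m i * m i) := by
    intro i
    simp only [hm]
    rcases le_total (- z i) 0 with h' | h'
    · simp [max_eq_right h']
    · rw [max_eq_left h']; ring
  have hzm' : ∀ i, - m i ≤ z i := by
    intro i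
    have := le_max_left (- z i) 0
    simp only [hm]; linarith
  have hmz : m = 0 := by
    by_contra hne
    have h2 := dot_self_pos hne
    have h1 := rayleigh hs h m
    have h3 : m ⬝ᵥ (Q *ᵥ (-m)) ≤ m ⬝ᵥ (Q *ᵥ z) := by
      refine Finset.sum_le_sum fun i _ => mul_le_mul_of_nonneg_left ?_ (hm0 i)
      exact mulVec_mono_aux hnn hzm' i
    rw [mulVec_neg, dotProduct_neg] at h3
    have h4 : l * (m ⬝ᵥ z) = ∑ i, m i + m ⬝ᵥ (Q *ᵥ z) := by
      simp only [dotProduct, Finset.mul_sum, ← Finset.sum_add_distrib]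
      refine Finset.sum_congr rfl fun i _ => ?_
      linear_combination m i * hz' i
    have h5 : m ⬝ᵥ z = - (m ⬝ᵥ m) := by
      simp only [dotProduct, ← Finset.sum_neg_distrib]
      exact Finset.sum_congr rfl fun i _ => hzm i
    have h6 : 0 ≤ ∑ i, m i := Finset.sum_nonneg fun i _ => hm0 i
    rw [h5] at h4
    nlinarith
  have hznn : ∀ i, 0 ≤ z i := by
    intro i
    have := hzm' i
    rw [hmz] at this
    simpa using this
  have hzpos : ∀ i, 0 < z i := by
    intro i
    have h1 := hz' i
    have h2 : 0 ≤ (Q *ᵥ z) i := mulVec_nonneg_aux hnn hznn i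
    by_contra hcon
    have : z i = 0 := le_antisymm (not_lt.1 hcon) (hznn i)
    rw [this] at h1
    linarith
  refine ⟨fun i => z i + z i.rev, fun i => add_pos (hzpos _) (hzpos _), ?_, ?_⟩
  · intro i; simp [add_comm]
  · intro i
    have : (fun i => z i + z i.rev) = z + fun i => z i.rev := rfl
    rw [this, mulVec_add, Pi.add_apply, rev_mulVec hr]
    have h1 := hz' i
    have h2 := hz' i.rev
    simp only [Pi.add_apply]
    linarith

/-- Rotation in the plane of `v` and `w`. -/
def rotUVW {n : ℕ} (v w : Fin n → ℝ) (c s : ℝ) : Matrix (Fin n) (Fin n) ℝ :=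
  1 + (c - 1) • (vecMulVec v v + vecMulVec w w) + s • (vecMulVec w v - vecMulVec v w)

lemma rot_orth {n : ℕ} {v w : Fin n → ℝ} {c s : ℝ} (hv : v ⬝ᵥ v = 1) (hw : w ⬝ᵥ w = 1)
    (hvw : v ⬝ᵥ w = 0) (hcs : c ^ 2 + s ^ 2 = 1) :
    rotUVW v w c (-s) * rotUVW v w c s = 1 := by
  have hwv : w ⬝ᵥ v = 0 := by rw [dotProduct_comm, hvw]
  simp only [rotUVW, add_mul, mul_add, sub_mul, mul_sub, smul_mul_assoc, mul_smul_comm, one_mul,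
    mul_one, vecMulVec_mul_vecMulVec, hv, hw, hvw, hwv, smul_add, smul_sub, smul_smul]
  ext i j
  simp only [Matrix.sub_apply, Matrix.smul_apply, Matrix.add_apply, vecMulVec_apply,
        Pi.smul_apply, smul_eq_mul]
  linear_combination (v i * v j + w i * w j) * hcs

/-- The explicit perturbed matrix. -/
def rotRes {n : ℕ} (Q : Matrix (Fin n) (Fin n) ℝ) (v w b : Fin n → ℝ) (e l β c s : ℝ) :
    Matrix (Fin n) (Fin n) ℝ :=
  Matrix.of fun i j => Q i j + (e - (l - β) * s ^ 2) * (v i * v j)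
    + s * (v i * ((c * l + β * (1 - c)) * w j - b j) + ((c * l + β * (1 - c)) * w i - b i) * v j)
    + (l * s ^ 2 + β * (1 - c) ^ 2) * (w i * w j) - (1 - c) * (w i * b j + b i * w j)

lemma rotRes_eq {n : ℕ} {Q : Matrix (Fin n) (Fin n) ℝ} {v w : Fin n → ℝ} {r e c s : ℝ}
    (hs : ∀ i j, Q i j = Q j i) (hQ : Q *ᵥ v = r • v)
    (hv : v ⬝ᵥ v = 1) (hw : w ⬝ᵥ w = 1)
    (hvw : v ⬝ᵥ w = 0) (hcs : c ^ 2 + s ^ 2 = 1) :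
    rotUVW v w c s * (Q + e • vecMulVec v v) * rotUVW v w c (-s) =
      rotRes Q v w (Q *ᵥ w) e (r + e) (w ⬝ᵥ (Q *ᵥ w)) c s := by
  have hwv : w ⬝ᵥ v = 0 := by rw [dotProduct_comm, hvw]
  have hT : ∀ x, x ᵥ* Q = Q *ᵥ x := by
    intro x
    rw [← mulVec_transpose]; congr 1; ext i j; exact hs j i
  have hbv : (Q *ᵥ w) ⬝ᵥ v = 0 := by
    rw [← hT, ← dotProduct_mulVec, hQ, dotProduct_smul, hwv, smul_zero]
  have hvb : v ⬝ᵥ (Q *ᵥ w) = 0 := by rw [dotProduct_comm, hbv]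
  have hbw : (Q *ᵥ w) ⬝ᵥ w = w ⬝ᵥ (Q *ᵥ w) := dotProduct_comm _ _
  have hm1 : ∀ x y : Fin n → ℝ, Q * vecMulVec x y = vecMulVec (Q *ᵥ x) y := fun x y => mul_vecMulVec _ _ _
  have hm2 : ∀ x y : Fin n → ℝ, vecMulVec x y * Q = vecMulVec x (Q *ᵥ y) := fun x y => by
    rw [vecMulVec_mul, hT]
  generalize hβ : w ⬝ᵥ (Q *ᵥ w) = β at *
  generalize hb : Q *ᵥ w = b at *
  simp only [rotUVW, add_mul, mul_add, sub_mul, mul_sub, smul_mul_assoc, mul_smul_comm, one_mul,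
    mul_one, vecMulVec_mul_vecMulVec, hv, hw, hvw, hwv, smul_add, smul_sub, smul_smul,
    hm1, hm2, hQ, hb, smul_vecMulVec, vecMulVec_smul, hbv, hvb, hbw, hβ,
    dotProduct_smul, smul_dotProduct]
  ext i j
  simp only [rotRes, Matrix.of_apply, Matrix.sub_apply, Matrix.smul_apply, Matrix.add_apply,
    vecMulVec_apply, Pi.smul_apply, smul_eq_mul]
  linear_combination (r + e) * v i * v j * hcs

lemma eigs_of_eq {n : ℕ} {Q R : Matrix (Fin (n+1)) (Fin (n+1)) ℝ} {r e : ℝ} {μ : Multiset ℝ}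
    (h : HasEigsM Q (r ::ₘ μ))
    (h2 : (X - C r) * R.charpoly = (X - C (r + e)) * Q.charpoly) :
    HasEigsM R ((r + e) ::ₘ μ) := by
  unfold HasEigsM at *
  rw [Multiset.map_cons, Multiset.prod_cons] at *
  apply mul_left_cancel₀ (X_sub_C_ne_zero r)
  rw [h2, h]; ring

lemma exists_c {n : ℕ} (b w : Fin n → ℝ) (l e : ℝ) (he : 0 < e) (h : ∀ i, 0 < w i → b i < l * w i) :
    ∃ c s : ℝ, 0 < c ∧ c < 1 ∧ 0 < s ∧ c ^ 2 + s ^ 2 = 1 ∧ l * s ^ 2 < e ∧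
      ∀ i, 0 < w i → b i < c * l * w i := by
  have h1 : ∀ᶠ c : ℝ in nhdsWithin 1 (Set.Iio 1), ∀ i, 0 < w i → b i < c * l * w i := by
    rw [Filter.eventually_all]
    intro i
    by_cases hi : 0 < w i
    · have : Filter.Tendsto (fun c : ℝ => c * l * w i) (nhdsWithin 1 (Set.Iio 1))
          (nhds (1 * l * w i)) :=
        (Continuous.tendsto (by fun_prop) 1).mono_left nhdsWithin_le_nhds
      filter_upwards [this.eventually (lt_mem_nhds (by simpa using h i hi))] with c hc _
      exact hc
    · exact Filter.Eventually.of_forall fun c h' => absurd h' hi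
  have h2 : ∀ᶠ c : ℝ in nhdsWithin 1 (Set.Iio 1), l * (1 - c ^ 2) < e := by
    have : Filter.Tendsto (fun c : ℝ => l * (1 - c ^ 2)) (nhdsWithin 1 (Set.Iio 1))
          (nhds (l * (1 - 1 ^ 2))) :=
        (Continuous.tendsto (by fun_prop) 1).mono_left nhdsWithin_le_nhds
    exact this.eventually (gt_mem_nhds (by simpa using he))
  have h3 : ∀ᶠ c : ℝ in nhdsWithin 1 (Set.Iio 1), 0 < c :=
    nhdsWithin_le_nhds (lt_mem_nhds one_pos)
  have h4 : ∀ᶠ c : ℝ in nhdsWithin 1 (Set.Iio 1), c < 1 := self_mem_nhdsWithin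
  obtain ⟨c, hc1, hc2, hc3, hc4⟩ := (h1.and (h2.and (h3.and h4))).exists
  have hp : 0 < 1 - c ^ 2 := by nlinarith
  refine ⟨c, Real.sqrt (1 - c ^ 2), hc3, hc4, Real.sqrt_pos.2 hp, ?_, ?_, hc1⟩
  · rw [Real.sq_sqrt hp.le]; ring
  · rwa [Real.sq_sqrt hp.le]

/-- Theorem 4.2: if `Q` is nonnegative bisymmetric with eigenvalues
`λ₀, λ₁ ≥ … ≥ λₙ`, where `λ₀` is the Perron root of `Q`, then for every `ε > 0` there is
a positive bisymmetric matrix with eigenvalues `λ₀ + ε, λ₁, …, λₙ`. -/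
theorem bisymm_positive_perturb (n : ℕ) (Q : Matrix (Fin (n + 1)) (Fin (n + 1)) ℝ)
    (hQnn : MatNonneg Q) (hQbs : IsBisymm Q)
    (lam : ℕ → ℝ)
    (hanti : ∀ i j, 1 ≤ i → i ≤ j → j ≤ n → lam j ≤ lam i)
    (heig : HasEigsM Q (lam 0 ::ₘ (Finset.Icc 1 n).val.map lam))
    (hperron : IsPerronRoot Q (lam 0))
    (ε : ℝ) (hε : 0 < ε) :
    ∃ Q' : Matrix (Fin (n + 1)) (Fin (n + 1)) ℝ,
      MatPos Q' ∧ IsBisymm Q' ∧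
        HasEigsM Q' ((lam 0 + ε) ::ₘ (Finset.Icc 1 n).val.map lam) := by
  obtain ⟨hs, hr⟩ := (isBisymm_iff Q).1 hQbs
  obtain ⟨v, hv0, hvr, hv1, hQv⟩ := exists_perron_vec hQnn hs hr hperron
  have hr0 : 0 ≤ lam 0 := by
    have h1 : v ⬝ᵥ (Q *ᵥ v) = lam 0 := by rw [hQv, dotProduct_smul, hv1]; simp
    rw [← h1]
    exact Finset.sum_nonneg fun i _ => mul_nonneg (hv0 i)
      (mulVec_nonneg_aux hQnn hv0 i)
  have hrank := rank_one_charpoly Q v (lam 0) ε hQv hv1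
  by_cases hall : ∀ i, 0 < v i
  · refine ⟨Q + ε • vecMulVec v v, ?_, ?_, eigs_of_eq heig hrank⟩
    · intro i j
      have := mul_pos hε (mul_pos (hall i) (hall j))
      have := hQnn i j
      simp only [Matrix.add_apply, Matrix.smul_apply, vecMulVec_apply, smul_eq_mul]
      linarith
    · rw [isBisymm_iff]
      refine ⟨fun i j => ?_, fun i j => ?_⟩
      · simp [vecMulVec_apply, hs i j, mul_comm]
      · simp [vecMulVec_apply, hr, hvr]
  push Not at hall
  obtain ⟨i0, hi0⟩ := hall
  have hi0 : v i0 = 0 := le_antisymm hi0 (hv0 i0)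
  obtain ⟨z, hz0, hzr, hzl⟩ := exists_sub_vec (l := lam 0 + ε) hQnn hs hr hperron hr0 (by linarith)
  -- block structure
  have hblock : ∀ i j, v i = 0 → 0 < v j → Q i j = 0 := by
    intro i j hi hj
    have h1 := congrFun hQv i
    simp only [Pi.smul_apply, hi, smul_zero, mulVec, dotProduct] at h1
    have h2 := (Finset.sum_eq_zero_iff_of_nonneg
      (fun k _ => mul_nonneg (hQnn i k) (hv0 k))).1 h1 j (Finset.mem_univ _)
    rcases mul_eq_zero.1 h2 with h | h
    · exact h
    · exact absurd h hj.ne'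
  set w0 : Fin (n+1) → ℝ := fun i => if v i = 0 then z i else 0 with hw0
  have hw0n : ∀ i, 0 ≤ w0 i := by
    intro i; simp only [hw0]; split_ifs
    · exact (hz0 i).le
    · exact le_rfl
  have hw0ne : w0 ≠ 0 := Function.ne_iff.2 ⟨i0, by simp [hw0, hi0, (hz0 i0).ne']⟩
  have hw0p := dot_self_pos hw0ne
  set a : ℝ := (Real.sqrt (w0 ⬝ᵥ w0))⁻¹ with ha
  have hapos : 0 < a := by positivity
  set w : Fin (n+1) → ℝ := a • w0 with hw
  have hw1 : w ⬝ᵥ w = 1 := by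
    rw [hw, smul_dotProduct, dotProduct_smul, smul_eq_mul, smul_eq_mul, ← mul_assoc, ha, ← mul_inv,
      Real.mul_self_sqrt hw0p.le, inv_mul_cancel₀ hw0p.ne']
  have hwn : ∀ i, 0 ≤ w i := fun i => mul_nonneg hapos.le (hw0n i)
  have hwz : ∀ i, 0 < v i → w i = 0 := by
    intro i hi; simp [hw, hw0, hi.ne']
  have hwp : ∀ i, v i = 0 → 0 < w i := by
    intro i hi
    have := mul_pos hapos (hz0 i)
    simpa [hw, hw0, hi] using this
  have hwr : ∀ i, w i.rev = w i := by
    intro i; simp [hw, hw0, hvr, hzr]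
  have hvw : v ⬝ᵥ w = 0 := by
    refine Finset.sum_eq_zero fun i _ => ?_
    rcases (hv0 i).eq_or_lt with h | h
    · simp [← h]
    · simp [hwz i h]
  set b := Q *ᵥ w with hb
  have hbn : ∀ i, 0 ≤ b i := fun i =>
    mulVec_nonneg_aux hQnn hwn i
  have hbr : ∀ i, b i.rev = b i := by
    intro i
    rw [hb, ← rev_mulVec hr]
    simp only [hwr]
  have hbz : ∀ i, 0 < v i → b i = 0 := by
    intro i hi
    simp only [hb, mulVec, dotProduct]
    refine Finset.sum_eq_zero fun j _ => ?_
    rcases (hv0 j).eq_or_lt with h | h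
    · rw [hs, hblock j i h.symm hi, zero_mul]
    · simp [hwz j h]
  have hbl : ∀ i, 0 < w i → b i < (lam 0 + ε) * w i := by
    intro i hi
    have hvi : v i = 0 := by
      by_contra hne
      have := hwz i (lt_of_le_of_ne (hv0 i) (Ne.symm hne))
      linarith
    have h1 : (Q *ᵥ w0) i ≤ (Q *ᵥ z) i := by
      refine mulVec_mono_aux hQnn (fun j => ?_) i
      simp only [hw0]; split_ifs
      · exact le_rfl
      · exact (hz0 j).le
    have h2 : b i = a * (Q *ᵥ w0) i := by rw [hb, hw, mulVec_smul]; rfl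
    have h3 : w i = a * z i := by simp [hw, hw0, hvi]
    rw [h2, h3]
    have := mul_lt_mul_of_pos_left (h1.trans_lt (hzl i)) hapos
    linarith
  obtain ⟨c, s, hc0, hc1, hs0, hcs, hls, hcl⟩ := exists_c b w (lam 0 + ε) ε hε hbl
  set l := lam 0 + ε with hl
  have hlpos : 0 < l := by linarith
  set β := w ⬝ᵥ b with hβ
  have hβ0 : 0 ≤ β := Finset.sum_nonneg fun i _ => mul_nonneg (hwn i) (hbn i)
  have hR : rotUVW v w c s * (Q + ε • vecMulVec v v) * rotUVW v w c (-s) =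
      rotRes Q v w b ε l β c s := rotRes_eq hs hQv hv1 hw1 hvw hcs
  refine ⟨rotRes Q v w b ε l β c s, ?_, ?_, ?_⟩
  · -- positivity
    have hst : ∀ j, v j = 0 → 0 < (c * l + β * (1 - c)) * w j - b j := by
      intro j hj
      have h1 := hcl j (hwp j hj)
      have h2 : 0 ≤ β * (1 - c) * w j := mul_nonneg (mul_nonneg hβ0 (by linarith)) (hwn j)
      nlinarith
    intro i j
    have hq := hQnn i j
    simp only [rotRes, Matrix.of_apply]
    rcases (hv0 i).eq_or_lt with hi | hi <;> rcases (hv0 j).eq_or_lt with hj | hj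
    · have hwi := hwp i hi.symm
      have hwj := hwp j hj.symm
      have h1 := mul_lt_mul_of_pos_left (hcl j hwj) hwi
      have h2 := mul_lt_mul_of_pos_left (hcl i hwi) hwj
      have h3 : (1 - c) * (w i * b j + b i * w j) < (1 - c) * (2 * c * l * (w i * w j)) :=
        mul_lt_mul_of_pos_left (by linarith) (by linarith)
      have hss : s ^ 2 = (1 - c) * (1 + c) := by linear_combination hcs
      have hww := mul_pos hwi hwj
      have h4 : 0 ≤ β * (1 - c) ^ 2 * (w i * w j) := by positivity
      have h5 : 0 ≤ l * (1 - c) ^ 2 * (w i * w j) := by positivity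
      rw [← hi, ← hj, hss]
      linarith
    · rw [← hi, hwz j hj, hbz j hj]
      have := mul_pos hs0 (mul_pos (hst i hi.symm) hj)
      linarith
    · rw [← hj, hwz i hi, hbz i hi]
      have := mul_pos hs0 (mul_pos hi (hst j hj.symm))
      linarith
    · rw [hwz i hi, hbz i hi, hwz j hj, hbz j hj]
      have h1 : 0 ≤ β * s ^ 2 := by positivity
      have := mul_pos (show 0 < ε - (l - β) * s ^ 2 by linarith) (mul_pos hi hj)
      linarith
  · rw [isBisymm_iff]
    refine ⟨fun i j => ?_, fun i j => ?_⟩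
    · simp only [rotRes, Matrix.of_apply, hs i j]; ring
    · simp only [rotRes, Matrix.of_apply, hr, hvr, hwr, hbr]
  · refine eigs_of_eq heig ?_
    rw [← hrank, ← hR, Matrix.charpoly_mul_comm, ← mul_assoc, rot_orth hv1 hw1 hvw hcs, one_mul]
end
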